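/- For β ∈ (0,1], the derivative of the Legendre transform H_β* of H_β(s) = max{s², |s|^((β+1)/β)} satisfies |d/dt H_β*(t)| ≤ min{|t|, |t|^β} for all t ∈ ℝ. -/

import Mathlib

theorem stmt7 (β : ℝ) (hβ : β ∈ Set.Ioc (0:ℝ) 1) (t : ℝ) :
    |deriv (fun u : ℝ => ⨆ s : ℝ, (u * s - max (s ^ 2) (|s| ^ ((β + 1) / β)))) t| ≤
      min |t| (|t| ^ β) := by
  obtain ⟨hb0, hb1⟩ := hβ
  have hp : 0 < (β + 1) / β := by positivity
  set H : ℝ → ℝ := fun s => max (s ^ 2) (|s| ^ ((β + 1) / β)) with hH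
  have hH0 : H 0 = 0 := by simp [hH, Real.zero_rpow hp.ne']
  have hHc : Continuous H := by
    apply Continuous.max (by fun_prop)
    exact continuous_abs.rpow_const (fun x => Or.inr hp.le)
  have hH1 : ∀ s, s ^ 2 ≤ H s := fun s => le_max_left _ _
  have hH2 : ∀ s, |s| ^ ((β + 1) / β) ≤ H s := fun s => le_max_right _ _
  change |deriv (fun u : ℝ => ⨆ s : ℝ, (u * s - H s)) t| ≤ _
  clear_value H
  set F : ℝ → ℝ := fun u : ℝ => ⨆ s : ℝ, (u * s - H s) with hF
  have hbdd : ∀ u : ℝ, BddAbove (Set.range fun s : ℝ => u * s - H s) := by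
    intro u
    refine ⟨u ^ 2, ?_⟩
    rintro _ ⟨s, rfl⟩
    have := hH1 s
    simp only
    nlinarith [sq_nonneg (u - s), sq_nonneg u, sq_nonneg s]
  have hnn : 0 ≤ min |t| (|t| ^ β) := by positivity
  by_cases hd : DifferentiableAt ℝ F t
  swap
  · rw [deriv_zero_of_not_differentiableAt hd]; simpa using hnn
  obtain ⟨s₀, -, hs₀⟩ := (isCompact_Icc (a := -|t|) (b := |t|)).exists_isMaxOn
    (f := fun s => t * s - H s) ⟨0, by simp⟩ (by fun_prop)
  have h0 : 0 ≤ t * s₀ - H s₀ := by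
    have := hs₀ (show (0:ℝ) ∈ Set.Icc (-|t|) |t| by simp)
    simpa [hH0] using this
  have hmax : ∀ s, t * s - H s ≤ t * s₀ - H s₀ := by
    intro s
    by_cases hs : s ∈ Set.Icc (-|t|) |t|
    · exact hs₀ hs
    · have h1 : |t| < |s| := by
        by_contra! h
        exact hs (abs_le.mp h)
      have h2 : t * s ≤ |t| * |s| := by rw [← abs_mul]; exact le_abs_self _
      have := hH1 s
      have h3 := sq_abs s
      nlinarith [abs_nonneg t, abs_nonneg s]
  have hFt : F t = t * s₀ - H s₀ := le_antisymm (ciSup_le hmax) (le_ciSup (hbdd t) s₀)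
  have hmin : IsLocalMin (fun u => F u - u * s₀) t := by
    refine Filter.Eventually.of_forall fun u => ?_
    have : u * s₀ - H s₀ ≤ F u := le_ciSup (hbdd u) s₀
    simp only
    linarith
  have hder : deriv F t = s₀ := by
    have h := hmin.hasDerivAt_eq_zero (hd.hasDerivAt.sub ((hasDerivAt_id t).mul_const s₀))
    linarith
  rw [hder]
  by_cases hz : s₀ = 0
  · simpa [hz] using hnn
  have hpos : 0 < |s₀| := abs_pos.mpr hz
  have hts : t * s₀ ≤ |t| * |s₀| := by rw [← abs_mul]; exact le_abs_self _
  refine le_min ?_ ?_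
  · have := hH1 s₀
    rw [← sq_abs] at this
    exact le_of_mul_le_mul_right (by nlinarith) hpos
  · have h := hH2 s₀
    have he : (β + 1) / β = β⁻¹ + 1 := by field_simp; ring
    rw [he, Real.rpow_add hpos, Real.rpow_one] at h
    have h4 : |s₀| ^ β⁻¹ ≤ |t| := le_of_mul_le_mul_right (by linarith) hpos
    have h5 := Real.rpow_le_rpow (by positivity) h4 hb0.le
    rwa [← Real.rpow_mul hpos.le, inv_mul_cancel₀ hb0.ne', Real.rpow_one] at h5
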